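/- Let 𝔣 be an additive, κ-Lipschitz, concave graph parameter, let V = A ∪ B be a finite set partitioned into disjoint sets A and B, and let d : V → ℕ. Then for any non-negative integer γ ≤ min(d(A), d(B)), F(⌊d(A)/2⌋, ⌊d(B)/2⌋, 0) ≤ F(⌊(d(A)−γ)/2⌋, ⌊(d(B)−γ)/2⌋, γ) + 7κ·√(γ·ln(1+γ)). -/

import Mathlib

open Finset Filter Topology MeasureTheory
open scoped Classical BigOperators ENNReal

structure Multigraph where
  (V : Type)
  [fintypeV : Fintype V]
  (edges : Multiset (Sym2 V))

attribute [instance] Multigraph.fintypeV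

def Multigraph.addEdge (G : Multigraph) (i j : G.V) : Multigraph :=
  { V := G.V, edges := s(i, j) ::ₘ G.edges }

def Multigraph.disjUnion (G₁ G₂ : Multigraph) : Multigraph :=
  { V := G₁.V ⊕ G₂.V,
    edges := G₁.edges.map (Sym2.map Sum.inl) + G₂.edges.map (Sym2.map Sum.inr) }

/-- A graph parameter is invariant under graph isomorphism. -/
def GraphParam.Invariant (f : Multigraph → ℝ) : Prop :=
  ∀ (G₁ G₂ : Multigraph) (e : G₁.V ≃ G₂.V),
    G₂.edges = G₁.edges.map (Sym2.map e) → f G₁ = f G₂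

def GraphParam.Additive (f : Multigraph → ℝ) : Prop :=
  ∀ G₁ G₂ : Multigraph, f (G₁.disjUnion G₂) = f G₁ + f G₂

def GraphParam.Lipschitz (f : Multigraph → ℝ) (κ : ℝ) : Prop :=
  ∀ (G : Multigraph) (i j : G.V), |f (G.addEdge i j) - f G| ≤ κ

def GraphParam.Concave (f : Multigraph → ℝ) : Prop :=
  ∀ (G : Multigraph) (x : G.V → ℝ), (∑ i, x i) = 0 →
    ∑ i, ∑ j, (f (G.addEdge i j) - f G) * x i * x j ≤ 0

abbrev HalfEdge (V : Type) (d : V → ℕ) : Type := Σ i : V, Fin (d i)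

def IsPairMatching {α : Type} (m : Finset (Sym2 α)) : Prop :=
  (∀ p ∈ m, ¬ p.IsDiag) ∧
    ∀ p ∈ m, ∀ q ∈ m, p ≠ q → ∀ h : α, h ∈ p → h ∉ q

def IsMaximalMatching {α : Type} (m : Finset (Sym2 α)) : Prop :=
  IsPairMatching m ∧ ∀ m' : Finset (Sym2 α), IsPairMatching m' → m ⊆ m' → m' = m

/-- The multigraph `G[m]` induced on `V` by a matching `m` of the half-edges. -/
def matchingGraph (V : Type) [Fintype V] (d : V → ℕ)
    (m : Finset (Sym2 (HalfEdge V d))) : Multigraph :=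
  { V := V, edges := m.val.map (Sym2.map Sigma.fst) }

noncomputable def maximalMatchings (V : Type) [Fintype V] [DecidableEq V] (d : V → ℕ) :
    Finset (Finset (Sym2 (HalfEdge V d))) :=
  Finset.univ.filter fun m => IsMaximalMatching m

/-- `E[f(𝔾_d)]`: expectation of `f` under the configuration model with degrees `d`. -/
noncomputable def configExpect (V : Type) [Fintype V] [DecidableEq V] (d : V → ℕ)
    (f : Multigraph → ℝ) : ℝ :=
  (∑ m ∈ maximalMatchings V d, f (matchingGraph V d m)) / ((maximalMatchings V d).card : ℝ)

/-- `E[f(𝔾^iid_{μ,n})]`. -/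
noncomputable def iidExpect (μ : ℕ → ℝ) (n : ℕ) (f : Multigraph → ℝ) : ℝ :=
  ∑' D : Fin n → ℕ, (∏ i, μ (D i)) * configExpect (Fin n) D f

noncomputable def tailSum (μ : ℕ → ℝ) (i : ℕ) : ℝ := ∑' k : ℕ, if i ≤ k then μ k else 0

/-- The Wasserstein distance `W(μ, μ') = Σ_{i≥1} |Σ_{k≥i} (μ k - μ' k)|`. -/
noncomputable def wasserstein (μ μ' : ℕ → ℝ) : ℝ :=
  ∑' i : ℕ, |tailSum μ (i + 1) - tailSum μ' (i + 1)|

/-- Empirical degree distribution of `d : Fin n → ℕ`. -/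
noncomputable def empirical (n : ℕ) (d : Fin n → ℕ) : ℕ → ℝ :=
  fun k => ((Finset.univ.filter fun i => d i = k).card : ℝ) / (n : ℝ)

/-- The degree sequences `d n` approach the degree distribution `μ` (with mean `Σ k·μ(k)`). -/
def Approaches (d : (n : ℕ) → Fin n → ℕ) (μ : ℕ → ℝ) : Prop :=
  (∀ k : ℕ, Tendsto (fun n => empirical n (d n) k) atTop (nhds (μ k))) ∧
    Tendsto (fun n => (∑ i, (d n i : ℝ)) / (n : ℝ)) atTop
      (nhds (∑' k : ℕ, (k : ℝ) * μ k))

def bothEnds {V : Type} {d : V → ℕ} (A : Finset V) (p : Sym2 (HalfEdge V d)) : Prop :=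
  ∀ h ∈ p, h.1 ∈ A

def crossEnds {V : Type} {d : V → ℕ} (A B : Finset V) (p : Sym2 (HalfEdge V d)) : Prop :=
  (∃ h ∈ p, h.1 ∈ A) ∧ (∃ h ∈ p, h.1 ∈ B)

/-- `M(α, β, γ)`: matchings with `α` pairs inside `A`, `β` pairs inside `B`, `γ` cross pairs. -/
noncomputable def Mset (V : Type) [Fintype V] [DecidableEq V] (d : V → ℕ) (A B : Finset V)
    (a b c : ℕ) : Finset (Finset (Sym2 (HalfEdge V d))) :=
  Finset.univ.filter fun m => IsPairMatching m ∧
    (m.filter fun p => bothEnds A p).card = a ∧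
    (m.filter fun p => bothEnds B p).card = b ∧
    (m.filter fun p => crossEnds A B p).card = c

/-- `F(α, β, γ)`: the average of `f (G[m])` over `m ∈ M(α, β, γ)`. -/
noncomputable def Fav (V : Type) [Fintype V] [DecidableEq V] (d : V → ℕ) (A B : Finset V)
    (f : Multigraph → ℝ) (a b c : ℕ) : ℝ :=
  (∑ m ∈ Mset V d A B a b c, f (matchingGraph V d m)) / ((Mset V d A B a b c).card : ℝ)

/-- `(α, β, γ)` is feasible: `2α + γ ≤ d(A)` and `2β + γ ≤ d(B)`. -/
def Feasible (V : Type) [Fintype V] (d : V → ℕ) (A B : Finset V) (a b c : ℕ) : Prop :=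
  2 * a + c ≤ ∑ i ∈ A, d i ∧ 2 * b + c ≤ ∑ i ∈ B, d i

set_option linter.unusedSectionVars false
set_option linter.unusedVariables false

/-! ### Arithmetic part -/

noncomputable def gpot (L : ℕ) (x : ℝ) : ℝ := x / 2 + (x - (2 * L + 1)) ^ 2 / (2 * (L + 1))

theorem arith_step (F : ℕ → ℕ → ℕ → ℝ) (DA DB : ℕ) (κ : ℝ) (hκ : 0 ≤ κ)
    (hS : ∀ a b c x y : ℕ, x + 2 * a + c = DA → y + 2 * b + c = DB → 2 ≤ x → 2 ≤ y →
      F (a + 1) b c + F a (b + 1) c ≤ 2 * F a b (c + 1) + 2 * κ / x + 2 * κ / y)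
    (L : ℕ) (hL : 1 ≤ L) (hN : (0 : ℝ) < (L : ℝ) + 1)
    (hstep : ∀ x : ℝ, gpot L (x - 1) + gpot L (x + 1) = 2 * gpot L x + 1 / (L + 1))
    (c : ℕ)
    (ihc : ∀ n a b x y : ℕ, a + b = n → x + 2 * a + c = DA → y + 2 * b + c = DB →
      L ≤ x + a → L ≤ y + b →
      F (DA / 2) (DB / 2) 0 ≤ F a b c + κ * (gpot L x + gpot L y + 3 * c / (L + 1)))
    (a b x y : ℕ) (hx : x + 2 * a + (c + 1) = DA) (hy : y + 2 * b + (c + 1) = DB)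
    (hxL : L ≤ x) (hyL : L ≤ y) :
    F (DA / 2) (DB / 2) 0 ≤
      F a b (c + 1) + κ * (gpot L x + gpot L y + 3 * ((c + 1 : ℕ) : ℝ) / (L + 1)) := by
  obtain ⟨x, rfl⟩ : ∃ x', x = x' + 1 := ⟨x - 1, by omega⟩
  obtain ⟨y, rfl⟩ : ∃ x', y = x' + 1 := ⟨y - 1, by omega⟩
  have e1 := ihc _ (a + 1) b x (y + 2) rfl (by omega) (by omega) (by omega) (by omega)
  have e2 := ihc _ a (b + 1) (x + 2) y rfl (by omega) (by omega) (by omega) (by omega)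
  have e3 := hS a b c (x + 2) (y + 2) (by omega) (by omega) (by omega) (by omega)
  have s1 := hstep ((x + 1 : ℕ) : ℝ)
  have s2 := hstep ((y + 1 : ℕ) : ℝ)
  have k : ∀ z : ℕ, L ≤ z + 1 → 2 * κ / ((z + 2 : ℕ) : ℝ) ≤ κ * (2 / (L + 1)) := by
    intro z hz
    have hz' : (L : ℝ) + 1 ≤ ((z + 2 : ℕ) : ℝ) := by exact_mod_cast (by omega : L + 1 ≤ z + 2)
    rw [show 2 * κ / ((z + 2 : ℕ) : ℝ) = κ * (2 / ((z + 2 : ℕ) : ℝ)) by ring]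
    apply mul_le_mul_of_nonneg_left _ hκ
    gcongr
  have k1 := k x hxL
  have k2 := k y hyL
  rw [show (((x + 1 : ℕ) : ℝ) - 1) = (x : ℝ) by push_cast; ring,
    show (((x + 1 : ℕ) : ℝ) + 1) = ((x + 2 : ℕ) : ℝ) by push_cast; ring] at s1
  rw [show (((y + 1 : ℕ) : ℝ) - 1) = (y : ℝ) by push_cast; ring,
    show (((y + 1 : ℕ) : ℝ) + 1) = ((y + 2 : ℕ) : ℝ) by push_cast; ring] at s2
  have key : κ * (gpot L x + gpot L ((y + 2 : ℕ) : ℝ) + 3 * c / (L + 1)) +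
      κ * (gpot L ((x + 2 : ℕ) : ℝ) + gpot L y + 3 * c / (L + 1)) + 2 * (κ * (2 / (L + 1))) =
      2 * (κ * (gpot L ((x + 1 : ℕ) : ℝ) + gpot L ((y + 1 : ℕ) : ℝ) +
        3 * ((c + 1 : ℕ) : ℝ) / (L + 1))) := by
    have : gpot L x + gpot L ((y + 2 : ℕ) : ℝ) + 3 * c / (L + 1) +
      (gpot L ((x + 2 : ℕ) : ℝ) + gpot L y + 3 * c / (L + 1)) + 2 * (2 / (L + 1)) =
      2 * (gpot L ((x + 1 : ℕ) : ℝ) + gpot L ((y + 1 : ℕ) : ℝ) +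
        3 * ((c + 1 : ℕ) : ℝ) / (L + 1)) := by
      push_cast at s1 s2 ⊢
      have : 3 * ((c : ℝ) + 1) / (L + 1) = 3 * c / (L + 1) + 3 * (1 / (L + 1)) := by ring
      rw [this]
      have : 2 / ((L : ℝ) + 1) = 2 * (1 / (L + 1)) := by ring
      rw [this]
      linarith
    linear_combination κ * this
  linarith

theorem arith_claim (F : ℕ → ℕ → ℕ → ℝ) (DA DB : ℕ) (κ : ℝ) (hκ : 0 ≤ κ)
    (h1 : ∀ a b c, 2 * (a + 1) + c ≤ DA → 2 * b + c ≤ DB → |F (a + 1) b c - F a b c| ≤ κ)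
    (h2 : ∀ a b c, 2 * a + c ≤ DA → 2 * (b + 1) + c ≤ DB → |F a (b + 1) c - F a b c| ≤ κ)
    (hS : ∀ a b c x y : ℕ, x + 2 * a + c = DA → y + 2 * b + c = DB → 2 ≤ x → 2 ≤ y →
      F (a + 1) b c + F a (b + 1) c ≤ 2 * F a b (c + 1) + 2 * κ / x + 2 * κ / y)
    (L : ℕ) (hL : 1 ≤ L) :
    ∀ c n a b x y : ℕ, a + b = n → x + 2 * a + c = DA → y + 2 * b + c = DB →
      L ≤ x + a → L ≤ y + b →
      F (DA / 2) (DB / 2) 0 ≤ F a b c + κ * (gpot L x + gpot L y + 3 * c / (L + 1)) := by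
  have hN : (0 : ℝ) < (L : ℝ) + 1 := by positivity
  have hT1 : ∀ k a b : ℕ, 2 * (a + k) ≤ DA → 2 * b ≤ DB → F (a + k) b 0 ≤ F a b 0 + κ * k := by
    intro k
    induction k with
    | zero => intro a b _ _; simp
    | succ k ih =>
      intro a b ha hb
      have := (abs_le.1 (h1 (a + k) b 0 (by omega) (by omega))).2
      have := ih a b (by omega) hb
      push_cast
      rw [← add_assoc]
      linarith
  have hT2 : ∀ k a b : ℕ, 2 * a ≤ DA → 2 * (b + k) ≤ DB → F a (b + k) 0 ≤ F a b 0 + κ * k := by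
    intro k
    induction k with
    | zero => intro a b _ _; simp
    | succ k ih =>
      intro a b ha hb
      have := (abs_le.1 (h2 a (b + k) 0 (by omega) (by omega))).2
      have := ih a b (by omega) (by omega)
      push_cast
      rw [← add_assoc]
      linarith
  have hrefl : ∀ x : ℕ, x < L → gpot L ((x + 2 : ℕ) : ℝ) + 1 ≤ gpot L x := by
    intro x hx
    have hx' : (x : ℝ) + 1 ≤ L := by exact_mod_cast hx
    have : gpot L x - (gpot L ((x + 2 : ℕ) : ℝ) + 1) = 2 * (L - 1 - x) / (L + 1) := by
      unfold gpot; push_cast; field_simp; ring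
    have h0 : 0 ≤ 2 * ((L : ℝ) - 1 - x) / (L + 1) := div_nonneg (by linarith) hN.le
    linarith
  have hterm : ∀ x : ℝ, x / 2 ≤ gpot L x := by
    intro x; unfold gpot
    have : 0 ≤ (x - (2 * L + 1)) ^ 2 / (2 * ((L : ℝ) + 1)) := by positivity
    linarith
  have hstep : ∀ x : ℝ, gpot L (x - 1) + gpot L (x + 1) = 2 * gpot L x + 1 / (L + 1) := by
    intro x; unfold gpot; field_simp; ring
  intro c
  induction c with
  | zero =>
    intro n a b x y _ hx hy _ _
    have e1 := hT1 (DA / 2 - a) a (DB / 2) (by omega) (by omega)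
    have e2 := hT2 (DB / 2 - b) a b (by omega) (by omega)
    rw [show a + (DA / 2 - a) = DA / 2 by omega] at e1
    rw [show b + (DB / 2 - b) = DB / 2 by omega] at e2
    have k1 : ((DA / 2 - a : ℕ) : ℝ) ≤ x / 2 := by
      have : 2 * (DA / 2 - a) ≤ x := by omega
      have : (2 : ℝ) * ((DA / 2 - a : ℕ) : ℝ) ≤ x := by exact_mod_cast this
      linarith
    have k2 : ((DB / 2 - b : ℕ) : ℝ) ≤ y / 2 := by
      have : 2 * (DB / 2 - b) ≤ y := by omega
      have : (2 : ℝ) * ((DB / 2 - b : ℕ) : ℝ) ≤ y := by exact_mod_cast this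
      linarith
    have k3 := hterm x
    have k4 := hterm y
    have : κ * (((DA / 2 - a : ℕ) : ℝ) + ((DB / 2 - b : ℕ) : ℝ)) ≤
      κ * (gpot L x + gpot L y + 3 * ((0 : ℕ) : ℝ) / (L + 1)) := by
      apply mul_le_mul_of_nonneg_left _ hκ
      simp; linarith
    linarith
  | succ c ihc =>
    intro n
    induction n with
    | zero =>
      intro a b x y hab hx hy hxa hyb
      obtain ⟨rfl, rfl⟩ : a = 0 ∧ b = 0 := by omega
      exact arith_step F DA DB κ hκ hS L hL hN hstep c ihc 0 0 x y hx hy (by omega) (by omega)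
    | succ n ihn =>
      intro a b x y hab hx hy hxa hyb
      by_cases hxL : x < L
      · obtain ⟨a, rfl⟩ : ∃ a', a = a' + 1 := ⟨a - 1, by omega⟩
        have e1 := ihn a b (x + 2) y (by omega) (by omega) hy (by omega) hyb
        have e2 := (abs_le.1 (h1 a b (c + 1) (by omega) (by omega))).1
        have e3 := mul_le_mul_of_nonneg_left (hrefl x hxL) hκ
        linarith
      by_cases hyL : y < L
      · obtain ⟨b, rfl⟩ : ∃ a', b = a' + 1 := ⟨b - 1, by omega⟩
        have e1 := ihn a b x (y + 2) (by omega) hx (by omega) (by omega) (by omega)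
        have e2 := (abs_le.1 (h2 a b (c + 1) (by omega) (by omega))).1
        have e3 := mul_le_mul_of_nonneg_left (hrefl y hyL) hκ
        linarith
      exact arith_step F DA DB κ hκ hS L hL hN hstep c ihc a b x y hx hy (by omega) (by omega)

theorem arith_main (F : ℕ → ℕ → ℕ → ℝ) (DA DB : ℕ) (κ : ℝ) (hκ : 0 ≤ κ)
    (h1 : ∀ a b c, 2 * (a + 1) + c ≤ DA → 2 * b + c ≤ DB → |F (a + 1) b c - F a b c| ≤ κ)
    (h2 : ∀ a b c, 2 * a + c ≤ DA → 2 * (b + 1) + c ≤ DB → |F a (b + 1) c - F a b c| ≤ κ)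
    (h3 : ∀ a b c, 2 * a + (c + 1) ≤ DA → 2 * b + (c + 1) ≤ DB → |F a b (c + 1) - F a b c| ≤ κ)
    (hS : ∀ a b c x y : ℕ, x + 2 * a + c = DA → y + 2 * b + c = DB → 2 ≤ x → 2 ≤ y →
      F (a + 1) b c + F a (b + 1) c ≤ 2 * F a b (c + 1) + 2 * κ / x + 2 * κ / y)
    (γ : ℕ) (hA : γ ≤ DA) (hB : γ ≤ DB) :
    F (DA / 2) (DB / 2) 0 ≤ F ((DA - γ) / 2) ((DB - γ) / 2) γ +
      7 * κ * Real.sqrt ((γ : ℝ) * Real.log (1 + (γ : ℝ))) := by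
  rcases Nat.eq_zero_or_pos γ with rfl | hpos
  · simp
  set L := Nat.sqrt γ with hLdef
  have hL : 1 ≤ L := Nat.sqrt_pos.2 hpos
  have hLle : L * L ≤ γ := Nat.sqrt_le γ
  have hLlt : γ ≤ L * L + 2 * L := by
    have : γ ≤ L * L + L + L := Nat.sqrt_le_add γ
    omega
  have hLγ : L ≤ γ := Nat.sqrt_le_self γ
  have hN : (0 : ℝ) < (L : ℝ) + 1 := by positivity
  obtain ⟨r, hr⟩ : ∃ r, γ = r + L := ⟨γ - L, by omega⟩
  have hrem : ∀ k a b c : ℕ, 2 * a + (c + k) ≤ DA → 2 * b + (c + k) ≤ DB →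
      F a b c ≤ F a b (c + k) + κ * k := by
    intro k
    induction k with
    | zero => intro a b c _ _; simp
    | succ k ih =>
      intro a b c ha hb
      have := (abs_le.1 (h3 a b (c + k) (by omega) (by omega))).1
      have := ih a b c (by omega) (by omega)
      push_cast
      rw [← add_assoc]
      linarith
  set a := (DA - γ) / 2
  set b := (DB - γ) / 2
  have e1 := hrem L a b r (by omega) (by omega)
  rw [← hr] at e1
  have hg : ∀ x : ℕ, (x = L ∨ x = L + 1) → gpot L x ≤ L + 1 / 2 := by
    rintro x (rfl | rfl)
    · unfold gpot; apply le_of_eq; field_simp; ring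
    · unfold gpot
      have : (L : ℝ) + 1 / 2 - (((L + 1 : ℕ) : ℝ) / 2 + (((L + 1 : ℕ) : ℝ) - (2 * L + 1)) ^ 2 / (2 * (L + 1)))
        = L / (2 * (L + 1)) := by push_cast; field_simp; ring
      have h0 : 0 ≤ (L : ℝ) / (2 * (L + 1)) := by positivity
      linarith
  have e2 := arith_claim F DA DB κ hκ h1 h2 hS L hL r (a + b) a b (DA - 2 * a - r) (DB - 2 * b - r)
    rfl (by omega) (by omega) (by omega) (by omega)
  have g1 := hg (DA - 2 * a - r) (by omega)
  have g2 := hg (DB - 2 * b - r) (by omega)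
  suffices hsuff : (3 * L + 1 + 3 * r / (L + 1) : ℝ) ≤
      7 * Real.sqrt ((γ : ℝ) * Real.log (1 + (γ : ℝ))) by
    have e3 : κ * (gpot L ((DA - 2 * a - r : ℕ) : ℝ) + gpot L ((DB - 2 * b - r : ℕ) : ℝ)
        + 3 * r / (L + 1)) ≤ κ * (2 * L + 1 + 3 * r / (L + 1)) :=
      mul_le_mul_of_nonneg_left (by linarith) hκ
    have e4 := mul_le_mul_of_nonneg_left hsuff hκ
    linarith
  rcases Nat.lt_or_ge γ 2 with hlt | hge
  · have hγ1 : γ = 1 := by omega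
    have hL1 : L = 1 := by rw [hLdef, hγ1]; exact Nat.sqrt_one
    have hr0 : r = 0 := by omega
    rw [hL1, hr0, hγ1]
    have hlog : (0.6931471803 : ℝ) < Real.log 2 := Real.log_two_gt_d9
    have : (4 / 7 : ℝ) ≤ Real.sqrt (((1 : ℕ) : ℝ) * Real.log (1 + ((1 : ℕ) : ℝ))) := by
      apply Real.le_sqrt_of_sq_le
      norm_num
      linarith
    push_cast at this ⊢
    linarith
  · have hlog : 1 ≤ Real.log (1 + (γ : ℝ)) := by
      rw [Real.le_log_iff_exp_le (by positivity)]
      have : (2 : ℝ) ≤ γ := by exact_mod_cast hge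
      have := Real.exp_one_lt_d9
      linarith
    have hLs : (L : ℝ) ≤ Real.sqrt ((γ : ℝ) * Real.log (1 + (γ : ℝ))) := by
      apply Real.le_sqrt_of_sq_le
      have h0 : (L : ℝ) ^ 2 ≤ γ := by rw [sq]; exact_mod_cast hLle
      have h1 : (γ : ℝ) * 1 ≤ γ * Real.log (1 + (γ : ℝ)) :=
        mul_le_mul_of_nonneg_left hlog (by positivity)
      linarith
    have hr3 : 3 * (r : ℝ) / (L + 1) ≤ 3 * L := by
      rw [div_le_iff₀ hN]
      have : r ≤ L * (L + 1) := by rw [mul_add]; omega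
      have : (r : ℝ) ≤ L * (L + 1) := by exact_mod_cast this
      linarith
    have : (1 : ℝ) ≤ L := by exact_mod_cast hL
    linarith

/-! ### Combinatorial part -/

section comb

variable {H : Type} [Fintype H] [DecidableEq H]

/-- number of ordered pairs in `P × Q` matched by `m` -/
def pcnt (P Q : Finset H) (m : Finset (Sym2 H)) : ℕ :=
  ((P ×ˢ Q).filter fun x => s(x.1, x.2) ∈ m).card

/-- free half-edges -/
def frees (P : Finset H) (m : Finset (Sym2 H)) : Finset H :=
  P.filter fun h => ∀ p ∈ m, h ∉ p

noncomputable def MM (X Y : Finset H) (a b c : ℕ) : Finset (Finset (Sym2 H)) :=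
  Finset.univ.filter fun m => IsPairMatching m ∧ pcnt X X m = 2 * a ∧ pcnt Y Y m = 2 * b ∧
    pcnt X Y m = c

theorem mem_frees {P : Finset H} {m : Finset (Sym2 H)} {h : H} :
    h ∈ frees P m ↔ h ∈ P ∧ ∀ p ∈ m, h ∉ p := by simp [frees]

theorem matching_unique {m : Finset (Sym2 H)} (hm : IsPairMatching m) {h k k' : H}
    (h1 : s(h, k) ∈ m) (h2 : s(h, k') ∈ m) : k = k' := by
  by_contra hne
  have : s(h, k) ≠ s(h, k') := by
    intro he
    exact hne (Sym2.congr_right.1 he)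
  exact hm.2 _ h1 _ h2 this h (Sym2.mem_mk_left _ _) (Sym2.mem_mk_left _ _)

theorem pcnt_comm (P Q : Finset H) (m : Finset (Sym2 H)) : pcnt P Q m = pcnt Q P m := by
  unfold pcnt
  apply Finset.card_bij (fun x _ => (x.2, x.1))
  · rintro ⟨x, y⟩ h
    simp only [mem_filter, mem_product] at h ⊢
    exact ⟨⟨h.1.2, h.1.1⟩, by rw [Sym2.eq_swap]; exact h.2⟩
  · rintro ⟨x, y⟩ _ ⟨x', y'⟩ _ h
    simp only [Prod.mk.injEq] at h ⊢
    exact ⟨h.2, h.1⟩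
  · rintro ⟨x, y⟩ h
    simp only [mem_filter, mem_product] at h
    refine ⟨(y, x), ?_, rfl⟩
    simp only [mem_filter, mem_product]
    exact ⟨⟨h.1.2, h.1.1⟩, by rw [Sym2.eq_swap]; exact h.2⟩

theorem card_frees {m : Finset (Sym2 H)} (hm : IsPairMatching m) (P : Finset H) :
    (frees P m).card + pcnt P univ m = P.card := by
  have h1 := Finset.card_filter_add_card_filter_not (s := P) (fun h => ∀ p ∈ m, h ∉ p)
  have h2 : pcnt P univ m = (P.filter fun h => ¬ ∀ p ∈ m, h ∉ p).card := by
    unfold pcnt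
    apply Finset.card_bij (fun x _ => x.1)
    · rintro ⟨x, y⟩ h
      simp only [mem_filter, mem_product] at h ⊢
      refine ⟨h.1.1, fun hh => hh _ h.2 (Sym2.mem_mk_left _ _)⟩
    · rintro ⟨x, y⟩ h ⟨x', y'⟩ h' he
      simp only [mem_filter, mem_product] at h h' he
      subst he
      rw [matching_unique hm h.2 h'.2]
    · intro x h
      simp only [mem_filter] at h
      obtain ⟨hx, hh⟩ := h
      push Not at hh
      obtain ⟨p, hp, hxp⟩ := hh
      obtain ⟨y, rfl⟩ := Sym2.mem_iff_exists.1 hxp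
      exact ⟨(x, y), by simp [hx, hp], rfl⟩
  rw [h2]
  exact h1

theorem pcnt_univ {X Y : Finset H} (hd : Disjoint X Y) (hu : X ∪ Y = univ) (P : Finset H)
    (m : Finset (Sym2 H)) : pcnt P univ m = pcnt P X m + pcnt P Y m := by
  unfold pcnt
  rw [← hu, Finset.product_union, Finset.filter_union, Finset.card_union_of_disjoint]
  apply Finset.disjoint_filter_filter
  rw [Finset.disjoint_product]
  exact Or.inr hd

theorem pcnt_insert (P Q : Finset H) {m : Finset (Sym2 H)} {h k : H} (hne : h ≠ k)
    (hnm : s(h, k) ∉ m) :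
    pcnt P Q (insert s(h, k) m) = pcnt P Q m + ((if h ∈ P ∧ k ∈ Q then 1 else 0)
      + (if k ∈ P ∧ h ∈ Q then 1 else 0)) := by
  unfold pcnt
  have : ((P ×ˢ Q).filter fun x => s(x.1, x.2) ∈ insert s(h, k) m) =
      ((P ×ˢ Q).filter fun x => s(x.1, x.2) ∈ m) ∪
      ((({(h, k)} : Finset (H × H)).filter fun x => x ∈ P ×ˢ Q) ∪
        (({(k, h)} : Finset (H × H)).filter fun x => x ∈ P ×ˢ Q)) := by
    ext ⟨x, y⟩
    simp only [mem_filter, mem_union, mem_insert, mem_singleton, Sym2.eq_iff, Prod.mk.injEq]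
    tauto
  rw [this, Finset.card_union_of_disjoint, Finset.card_union_of_disjoint]
  · congr 2
    · rw [Finset.filter_singleton]; simp only [mem_product]; split_ifs <;> simp
    · rw [Finset.filter_singleton]; simp only [mem_product]; split_ifs <;> simp
  · apply Finset.disjoint_filter_filter
    simp [hne]
  · rw [Finset.disjoint_left]
    rintro ⟨x, y⟩ h1 h2
    simp only [mem_filter, mem_union, mem_singleton, Prod.mk.injEq] at h1 h2
    rcases h2 with ⟨⟨rfl, rfl⟩, _⟩ | ⟨⟨rfl, rfl⟩, _⟩
    · exact hnm h1.2
    · rw [Sym2.eq_swap] at hnm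
      exact hnm h1.2

theorem notMem_of_free {m : Finset (Sym2 H)} {h k : H} (hf : ∀ p ∈ m, h ∉ p) : s(h, k) ∉ m :=
  fun hh => hf _ hh (Sym2.mem_mk_left _ _)

theorem matching_insert {m : Finset (Sym2 H)} (hm : IsPairMatching m) {h k : H} (hne : h ≠ k)
    (hf : ∀ p ∈ m, h ∉ p) (hf' : ∀ p ∈ m, k ∉ p) : IsPairMatching (insert s(h, k) m) := by
  constructor
  · intro p hp
    rcases Finset.mem_insert.1 hp with rfl | hp
    · simpa using hne
    · exact hm.1 p hp
  · intro p hp q hq hpq x hx hx'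
    rcases Finset.mem_insert.1 hp with rfl | hp' <;> rcases Finset.mem_insert.1 hq with rfl | hq'
    · exact hpq rfl
    · rcases Sym2.mem_iff.1 hx with rfl | rfl
      · exact hf _ hq' hx'
      · exact hf' _ hq' hx'
    · rcases Sym2.mem_iff.1 hx' with rfl | rfl
      · exact hf _ hp' hx
      · exact hf' _ hp' hx
    · exact hm.2 p hp' q hq' hpq x hx hx'

theorem matching_erase {m : Finset (Sym2 H)} (hm : IsPairMatching m) (q : Sym2 H) :
    IsPairMatching (m.erase q) :=
  ⟨fun p hp => hm.1 p (Finset.mem_of_mem_erase hp), fun p hp q hq =>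
    hm.2 p (Finset.mem_of_mem_erase hp) q (Finset.mem_of_mem_erase hq)⟩

theorem free_erase {m : Finset (Sym2 H)} (hm : IsPairMatching m) {q : Sym2 H} (hq : q ∈ m)
    {h : H} (hh : h ∈ q) : ∀ p ∈ m.erase q, h ∉ p := by
  intro p hp hhp
  exact hm.2 p (Finset.mem_of_mem_erase hp) q hq (Finset.ne_of_mem_erase hp) h hhp hh

/-- the ordered pairs that can be added to `m` -/
def addable (P Q : Finset H) (m : Finset (Sym2 H)) : Finset (H × H) :=
  (frees P m ×ˢ frees Q m).filter fun x => x.1 ≠ x.2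

theorem sum_transfer (P Q : Finset H) (M M' : Finset (Finset (Sym2 H)))
    (hM : ∀ m ∈ M, IsPairMatching m) (hM' : ∀ m ∈ M', IsPairMatching m)
    (hins : ∀ (m : Finset (Sym2 H)) (h k : H), IsPairMatching m → h ∈ P → k ∈ Q → h ≠ k →
      (∀ p ∈ m, h ∉ p) → (∀ p ∈ m, k ∉ p) → (m ∈ M ↔ insert s(h, k) m ∈ M'))
    (ψ : Finset (Sym2 H) → ℝ) :
    ∑ m' ∈ M', ∑ _x ∈ (P ×ˢ Q).filter (fun x => s(x.1, x.2) ∈ m'), ψ m' =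
      ∑ m ∈ M, ∑ x ∈ addable P Q m, ψ (insert s(x.1, x.2) m) := by
  rw [Finset.sum_sigma', Finset.sum_sigma']
  refine Finset.sum_bij' (fun z _ => ⟨z.1.erase s(z.2.1, z.2.2), z.2⟩)
    (fun z _ => ⟨insert s(z.2.1, z.2.2) z.1, z.2⟩) ?_ ?_ ?_ ?_ ?_
  · rintro ⟨m, x, y⟩ hz
    simp only [mem_sigma, mem_filter, mem_product] at hz
    obtain ⟨hm, ⟨hx, hy⟩, hs⟩ := hz
    have hmm := hM' m hm
    have hne : x ≠ y := by simpa using hmm.1 _ hs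
    have f1 := free_erase hmm hs (Sym2.mem_mk_left x y)
    have f2 := free_erase hmm hs (Sym2.mem_mk_right x y)
    simp only [mem_sigma, addable, mem_filter, mem_product, mem_frees]
    refine ⟨?_, ⟨⟨hx, f1⟩, hy, f2⟩, hne⟩
    rw [hins _ x y (matching_erase hmm _) hx hy hne f1 f2, Finset.insert_erase hs]
    exact hm
  · rintro ⟨m, x, y⟩ hz
    simp only [mem_sigma, addable, mem_filter, mem_product, mem_frees] at hz
    obtain ⟨hm, ⟨⟨hx, f1⟩, hy, f2⟩, hne⟩ := hz
    simp only [mem_sigma, mem_filter, mem_product]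
    refine ⟨?_, ⟨hx, hy⟩, Finset.mem_insert_self _ _⟩
    exact (hins m x y (hM m hm) hx hy hne f1 f2).1 hm
  · rintro ⟨m, x, y⟩ hz
    simp only [mem_sigma, mem_filter, mem_product] at hz
    simp only [Finset.insert_erase hz.2.2]
  · rintro ⟨m, x, y⟩ hz
    simp only [mem_sigma, addable, mem_filter, mem_product, mem_frees] at hz
    obtain ⟨hm, ⟨⟨hx, f1⟩, hy, f2⟩, hne⟩ := hz
    simp only [Finset.erase_insert (notMem_of_free f1)]
  · rintro ⟨m, x, y⟩ hz
    simp only [mem_sigma, mem_filter, mem_product] at hz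
    simp only [Finset.insert_erase hz.2.2]

noncomputable def avg (M : Finset (Finset (Sym2 H))) (ψ : Finset (Sym2 H) → ℝ) : ℝ :=
  (∑ m ∈ M, ψ m) / (M.card : ℝ)

theorem avg_transfer (P Q : Finset H) (M M' : Finset (Finset (Sym2 H)))
    (hM : ∀ m ∈ M, IsPairMatching m) (hM' : ∀ m ∈ M', IsPairMatching m)
    (hins : ∀ (m : Finset (Sym2 H)) (h k : H), IsPairMatching m → h ∈ P → k ∈ Q → h ≠ k →
      (∀ p ∈ m, h ∉ p) → (∀ p ∈ m, k ∉ p) → (m ∈ M ↔ insert s(h, k) m ∈ M'))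
    (K C : ℕ) (hK : 0 < K) (hC : 0 < C) (hK' : ∀ m ∈ M', pcnt P Q m = K)
    (hC' : ∀ m ∈ M, (addable P Q m).card = C) (hne : M.Nonempty) :
    M'.Nonempty ∧ ∀ ψ : Finset (Sym2 H) → ℝ,
      avg M' ψ = avg M fun m => (∑ x ∈ addable P Q m, ψ (insert s(x.1, x.2) m)) / (C : ℝ) := by
  have key : ∀ ψ : Finset (Sym2 H) → ℝ, (K : ℝ) * ∑ m ∈ M', ψ m =
      ∑ m ∈ M, ∑ x ∈ addable P Q m, ψ (insert s(x.1, x.2) m) := by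
    intro ψ
    rw [← sum_transfer P Q M M' hM hM' hins ψ, Finset.mul_sum]
    apply Finset.sum_congr rfl
    intro m hm
    rw [Finset.sum_const, nsmul_eq_mul, ← hK' m hm]
    rfl
  have k1 : (K : ℝ) * M'.card = C * M.card := by
    have := key fun _ => 1
    simp only [Finset.sum_const, nsmul_eq_mul, mul_one] at this
    rw [this, Finset.sum_congr rfl (fun m hm => by rw [hC' m hm])]
    simp [mul_comm]
  have hMc : (0 : ℝ) < M.card := by exact_mod_cast hne.card_pos
  have hKr : (0 : ℝ) < K := by exact_mod_cast hK
  have hCr : (0 : ℝ) < C := by exact_mod_cast hC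
  have hM'c : (0 : ℝ) < M'.card := by
    have : (0 : ℝ) < K * M'.card := by rw [k1]; positivity
    exact pos_of_mul_pos_right this hKr.le
  refine ⟨Finset.card_pos.1 (by exact_mod_cast hM'c), fun ψ => ?_⟩
  unfold avg
  rw [← Finset.sum_div, ← key ψ, div_div, ← k1]
  field_simp

theorem avg_le_avg {M : Finset (Finset (Sym2 H))} {ψ φ : Finset (Sym2 H) → ℝ}
    (h : ∀ m ∈ M, ψ m ≤ φ m) : avg M ψ ≤ avg M φ := by
  unfold avg
  exact div_le_div_of_nonneg_right (Finset.sum_le_sum h) (by positivity)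

theorem avg_add_const {M : Finset (Finset (Sym2 H))} (hne : M.Nonempty)
    (ψ : Finset (Sym2 H) → ℝ) (t : ℝ) : avg M (fun m => ψ m + t) = avg M ψ + t := by
  have hMc : (0 : ℝ) < M.card := by exact_mod_cast hne.card_pos
  unfold avg
  rw [Finset.sum_add_distrib]
  simp only [Finset.sum_const, nsmul_eq_mul]
  field_simp

theorem avg_add {M : Finset (Finset (Sym2 H))} (ψ φ : Finset (Sym2 H) → ℝ) :
    avg M (fun m => ψ m + φ m) = avg M ψ + avg M φ := by
  unfold avg
  rw [Finset.sum_add_distrib, add_div]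

variable {X Y : Finset H}

theorem MM_matching {a b c : ℕ} : ∀ m ∈ MM X Y a b c, IsPairMatching m := by
  intro m hm
  simp only [MM, mem_filter] at hm
  exact hm.2.1

theorem MM_cardX (hd : Disjoint X Y) (hu : X ∪ Y = univ) {a b c x : ℕ}
    (hx : x + 2 * a + c = X.card) : ∀ m ∈ MM X Y a b c, (frees X m).card = x := by
  intro m hm
  simp only [MM, mem_filter] at hm
  have h1 := card_frees hm.2.1 X
  rw [pcnt_univ hd hu] at h1
  omega

theorem MM_cardY (hd : Disjoint X Y) (hu : X ∪ Y = univ) {a b c y : ℕ}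
    (hy : y + 2 * b + c = Y.card) : ∀ m ∈ MM X Y a b c, (frees Y m).card = y := by
  intro m hm
  simp only [MM, mem_filter] at hm
  have h1 := card_frees hm.2.1 Y
  rw [pcnt_univ hd hu, pcnt_comm Y X] at h1
  omega

theorem addable_self (P : Finset H) (m : Finset (Sym2 H)) :
    addable P P m = (frees P m).offDiag := by
  ext ⟨x, y⟩
  simp [addable, mem_offDiag, and_assoc]

theorem addable_cross (hd : Disjoint X Y) (m : Finset (Sym2 H)) :
    addable X Y m = frees X m ×ˢ frees Y m := by
  unfold addable
  apply Finset.filter_true_of_mem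
  rintro ⟨x, y⟩ h
  simp only [mem_product, mem_frees] at h
  rintro (rfl : x = y)
  exact Finset.disjoint_left.1 hd h.1.1 h.2.1

theorem MM_transferX (hd : Disjoint X Y) (hu : X ∪ Y = univ) {a b c x : ℕ}
    (hx : x + 2 * a + c = X.card) (h2 : 2 ≤ x) (hne : (MM X Y a b c).Nonempty) :
    (MM X Y (a + 1) b c).Nonempty ∧ ∀ ψ : Finset (Sym2 H) → ℝ,
      avg (MM X Y (a + 1) b c) ψ = avg (MM X Y a b c)
        fun m => (∑ z ∈ addable X X m, ψ (insert s(z.1, z.2) m)) / ((x * x - x : ℕ) : ℝ) := by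
  refine avg_transfer X X _ _ MM_matching MM_matching ?_ (2 * (a + 1)) (x * x - x) (by omega) ?_
    ?_ ?_ hne
  · intro m h k hm hh hk hhk f1 f2
    have hh' := Finset.disjoint_left.1 hd hh
    have hk' := Finset.disjoint_left.1 hd hk
    have hi := matching_insert hm hhk f1 f2
    have hn := notMem_of_free (k := k) f1
    simp only [MM, mem_filter, mem_univ, true_and, pcnt_insert _ _ hhk hn, hm, hi, hh, hk, hh', hk']
    simp
    omega
  · have : x * 2 ≤ x * x := Nat.mul_le_mul_left x h2
    omega
  · intro m hm
    simp only [MM, mem_filter] at hm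
    exact hm.2.2.1
  · intro m hm
    rw [addable_self, Finset.offDiag_card, MM_cardX hd hu hx m hm]

theorem MM_transferY (hd : Disjoint X Y) (hu : X ∪ Y = univ) {a b c y : ℕ}
    (hy : y + 2 * b + c = Y.card) (h2 : 2 ≤ y) (hne : (MM X Y a b c).Nonempty) :
    (MM X Y a (b + 1) c).Nonempty ∧ ∀ ψ : Finset (Sym2 H) → ℝ,
      avg (MM X Y a (b + 1) c) ψ = avg (MM X Y a b c)
        fun m => (∑ z ∈ addable Y Y m, ψ (insert s(z.1, z.2) m)) / ((y * y - y : ℕ) : ℝ) := by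
  refine avg_transfer Y Y _ _ MM_matching MM_matching ?_ (2 * (b + 1)) (y * y - y) (by omega) ?_
    ?_ ?_ hne
  · intro m h k hm hh hk hhk f1 f2
    have hh' := Finset.disjoint_right.1 hd hh
    have hk' := Finset.disjoint_right.1 hd hk
    have hi := matching_insert hm hhk f1 f2
    have hn := notMem_of_free (k := k) f1
    simp only [MM, mem_filter, mem_univ, true_and, pcnt_insert _ _ hhk hn, hm, hi, hh, hk, hh', hk']
    simp
    omega
  · have : y * 2 ≤ y * y := Nat.mul_le_mul_left y h2
    omega
  · intro m hm
    simp only [MM, mem_filter] at hm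
    exact hm.2.2.2.1
  · intro m hm
    rw [addable_self, Finset.offDiag_card, MM_cardY hd hu hy m hm]

theorem MM_transferC (hd : Disjoint X Y) (hu : X ∪ Y = univ) {a b c x y : ℕ}
    (hx : x + 2 * a + c = X.card) (hy : y + 2 * b + c = Y.card) (hx1 : 1 ≤ x) (hy1 : 1 ≤ y)
    (hne : (MM X Y a b c).Nonempty) :
    (MM X Y a b (c + 1)).Nonempty ∧ ∀ ψ : Finset (Sym2 H) → ℝ,
      avg (MM X Y a b (c + 1)) ψ = avg (MM X Y a b c)
        fun m => (∑ z ∈ addable X Y m, ψ (insert s(z.1, z.2) m)) / ((x * y : ℕ) : ℝ) := by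
  refine avg_transfer X Y _ _ MM_matching MM_matching ?_ (c + 1) (x * y) (by omega) ?_
    ?_ ?_ hne
  · intro m h k hm hh hk hhk f1 f2
    have hh' := Finset.disjoint_left.1 hd hh
    have hk' := Finset.disjoint_right.1 hd hk
    have hi := matching_insert hm hhk f1 f2
    have hn := notMem_of_free (k := k) f1
    simp only [MM, mem_filter, mem_univ, true_and, pcnt_insert _ _ hhk hn, hm, hi, hh, hk, hh', hk']
    simp
  · exact Nat.mul_pos hx1 hy1
  · intro m hm
    simp only [MM, mem_filter] at hm
    exact hm.2.2.2.2
  · intro m hm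
    rw [addable_cross hd, Finset.card_product, MM_cardX hd hu hx m hm, MM_cardY hd hu hy m hm]

theorem MM_nonempty (hd : Disjoint X Y) (hu : X ∪ Y = univ) :
    ∀ a b c : ℕ, 2 * a + c ≤ X.card → 2 * b + c ≤ Y.card → (MM X Y a b c).Nonempty := by
  have h0 : (MM X Y 0 0 0).Nonempty := ⟨∅, by simp [MM, pcnt, IsPairMatching]⟩
  have hA : ∀ a : ℕ, 2 * a ≤ X.card → (MM X Y a 0 0).Nonempty := by
    intro a
    induction a with
    | zero => intro _; exact h0
    | succ a ih =>
      intro ha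
      exact (MM_transferX hd hu (x := X.card - 2 * a) (by omega) (by omega) (ih (by omega))).1
  have hB : ∀ b a : ℕ, 2 * a ≤ X.card → 2 * b ≤ Y.card → (MM X Y a b 0).Nonempty := by
    intro b
    induction b with
    | zero => intro a ha _; exact hA a ha
    | succ b ih =>
      intro a ha hb
      exact (MM_transferY hd hu (y := Y.card - 2 * b) (by omega) (by omega)
        (ih a ha (by omega))).1
  intro a b c
  induction c with
  | zero => intro ha hb; exact hB b a ha hb
  | succ c ih =>
    intro ha hb
    exact (MM_transferC hd hu (x := X.card - 2 * a - c) (y := Y.card - 2 * b - c) (by omega)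
      (by omega) (by omega) (by omega) (ih (by omega) (by omega))).1

/-- Increment structure for a function of matchings. -/
def Incr (φ : Finset (Sym2 H) → ℝ) (κ : ℝ) (m : Finset (Sym2 H)) (D : H → H → ℝ) : Prop :=
  (∀ h k, D h k = D k h) ∧ (∀ h k, |D h k| ≤ κ) ∧
  (∀ h k, s(h, k) ∉ m → φ (insert s(h, k) m) = φ m + D h k) ∧
  (∀ y : H → ℝ, ∑ h, y h = 0 → ∑ h, ∑ k, D h k * y h * y k ≤ 0)

theorem addable_sum {φ : Finset (Sym2 H) → ℝ} {κ : ℝ} {m : Finset (Sym2 H)} {D : H → H → ℝ}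
    (hD : Incr φ κ m D) (P Q : Finset H) {C : ℕ} (hC : (addable P Q m).card = C) (hC0 : 0 < C) :
    (∑ z ∈ addable P Q m, φ (insert s(z.1, z.2) m)) / (C : ℝ) =
      φ m + (∑ z ∈ addable P Q m, D z.1 z.2) / C := by
  have hCr : (0 : ℝ) < C := by exact_mod_cast hC0
  have : ∑ z ∈ addable P Q m, φ (insert s(z.1, z.2) m) = ∑ z ∈ addable P Q m, (φ m + D z.1 z.2) := by
    apply Finset.sum_congr rfl
    rintro ⟨x, y⟩ hz
    simp only [addable, mem_filter, mem_product, mem_frees] at hz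
    exact hD.2.2.1 x y (notMem_of_free hz.1.1.2)
  rw [this, Finset.sum_add_distrib, Finset.sum_const, nsmul_eq_mul, hC]
  field_simp

theorem addable_abs {φ : Finset (Sym2 H) → ℝ} {κ : ℝ} {m : Finset (Sym2 H)} {D : H → H → ℝ}
    (hD : Incr φ κ m D) (P Q : Finset H) {C : ℕ} (hC : (addable P Q m).card = C) (hC0 : 0 < C) :
    |(∑ z ∈ addable P Q m, φ (insert s(z.1, z.2) m)) / (C : ℝ) - φ m| ≤ κ := by
  have hCr : (0 : ℝ) < C := by exact_mod_cast hC0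
  rw [addable_sum hD P Q hC hC0, add_sub_cancel_left, abs_div, abs_of_pos hCr, div_le_iff₀ hCr]
  calc |∑ z ∈ addable P Q m, D z.1 z.2| ≤ ∑ z ∈ addable P Q m, |D z.1 z.2| :=
        Finset.abs_sum_le_sum_abs _ _
    _ ≤ ∑ z ∈ addable P Q m, κ := Finset.sum_le_sum fun z _ => hD.2.1 _ _
    _ = κ * C := by rw [Finset.sum_const, nsmul_eq_mul, hC, mul_comm]

theorem avg_abs {M : Finset (Finset (Sym2 H))} (hne : M.Nonempty) {ψ φ : Finset (Sym2 H) → ℝ}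
    {κ : ℝ} (h : ∀ m ∈ M, |ψ m - φ m| ≤ κ) : |avg M ψ - avg M φ| ≤ κ := by
  rw [abs_le]
  have h1 : avg M ψ ≤ avg M (fun m => φ m + κ) :=
    avg_le_avg fun m hm => by have := (abs_le.1 (h m hm)).2; linarith
  have h2 : avg M φ ≤ avg M (fun m => ψ m + κ) :=
    avg_le_avg fun m hm => by have := (abs_le.1 (h m hm)).1; linarith
  rw [avg_add_const hne] at h1 h2
  constructor <;> linarith

theorem concave_local {D : H → H → ℝ} {κ : ℝ} (hsym : ∀ h k, D h k = D k h)
    (hlip : ∀ h k, |D h k| ≤ κ)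
    (hcon : ∀ y : H → ℝ, ∑ h, y h = 0 → ∑ h, ∑ k, D h k * y h * y k ≤ 0)
    (U W : Finset H) {x y : ℕ} (hU : U.card = x) (hW : W.card = y) (hx : 2 ≤ x) (hy : 2 ≤ y) :
    (∑ z ∈ U.offDiag, D z.1 z.2) / ((x * x - x : ℕ) : ℝ) +
      (∑ z ∈ W.offDiag, D z.1 z.2) / ((y * y - y : ℕ) : ℝ) ≤
      2 * ((∑ z ∈ U ×ˢ W, D z.1 z.2) / ((x * y : ℕ) : ℝ)) + (2 * κ / x + 2 * κ / y) := by
  have hxr : (2 : ℝ) ≤ x := by exact_mod_cast hx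
  have hyr : (2 : ℝ) ≤ y := by exact_mod_cast hy
  have hx0 : (0 : ℝ) < x := by linarith
  have hy0 : (0 : ℝ) < y := by linarith
  have part : ∀ (Z : Finset H) (n : ℕ), Z.card = n → 2 ≤ n →
      (∑ z ∈ Z.offDiag, D z.1 z.2) / ((n * n - n : ℕ) : ℝ) ≤
        (∑ z ∈ Z ×ˢ Z, D z.1 z.2) / ((n : ℝ) * n) + 2 * κ / n := by
    intro Z n hZ hn
    have hnr : (2 : ℝ) ≤ n := by exact_mod_cast hn
    have hn0 : (0 : ℝ) < n := by linarith
    have hn1 : (0 : ℝ) < (n : ℝ) - 1 := by linarith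
    have hle : n ≤ n * n := Nat.le_mul_self n
    have hcast : ((n * n - n : ℕ) : ℝ) = n * (n - 1) := by
      rw [Nat.cast_sub hle]; push_cast; ring
    have hsplit : ∑ z ∈ Z ×ˢ Z, D z.1 z.2 = ∑ z ∈ Z.diag, D z.1 z.2 + ∑ z ∈ Z.offDiag, D z.1 z.2 := by
      rw [← Finset.diag_union_offDiag, Finset.sum_union (Finset.disjoint_diag_offDiag Z)]
    have hdiag : -(n * κ) ≤ ∑ z ∈ Z.diag, D z.1 z.2 := by
      have : ∑ z ∈ Z.diag, (-κ) ≤ ∑ z ∈ Z.diag, D z.1 z.2 :=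
        Finset.sum_le_sum fun z _ => (abs_le.1 (hlip _ _)).1
      rw [Finset.sum_const, Finset.diag_card, hZ, nsmul_eq_mul] at this
      linarith
    have hoff : ∑ z ∈ Z.offDiag, D z.1 z.2 ≤ n * (n - 1) * κ := by
      have : ∑ z ∈ Z.offDiag, D z.1 z.2 ≤ ∑ z ∈ Z.offDiag, κ :=
        Finset.sum_le_sum fun z _ => (abs_le.1 (hlip _ _)).2
      rw [Finset.sum_const, Finset.offDiag_card, hZ, nsmul_eq_mul, hcast] at this
      linarith
    rw [hsplit, hcast]
    set S := ∑ z ∈ Z.offDiag, D z.1 z.2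
    set T := ∑ z ∈ Z.diag, D z.1 z.2
    have e : (T + S) / ((n : ℝ) * n) + 2 * κ / n - S / (n * (n - 1)) =
        ((T + n * κ) * (n - 1) + (n * (n - 1) * κ - S)) / (n * n * (n - 1)) := by
      field_simp; ring
    have : 0 ≤ ((T + n * κ) * (n - 1) + (n * (n - 1) * κ - S)) / (n * n * ((n : ℝ) - 1)) := by
      apply div_nonneg _ (by positivity)
      have := mul_nonneg (by linarith : 0 ≤ T + n * κ) hn1.le
      linarith
    linarith
  have p1 := part U x hU hx
  have p2 := part W y hW hy
  have hc := hcon (fun h => (if h ∈ U then (1 : ℝ) / x else 0) - (if h ∈ W then (1 : ℝ) / y else 0)) (by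
    rw [Finset.sum_sub_distrib, ← Finset.sum_filter, ← Finset.sum_filter]
    simp only [Finset.filter_univ_mem, Finset.sum_const, hU, hW, nsmul_eq_mul]
    field_simp
    simp)
  have hexp : ∑ h, ∑ k, D h k * ((if h ∈ U then (1 : ℝ) / x else 0) - (if h ∈ W then (1 : ℝ) / y else 0))
      * ((if k ∈ U then (1 : ℝ) / x else 0) - (if k ∈ W then (1 : ℝ) / y else 0)) =
      (∑ z ∈ U ×ˢ U, D z.1 z.2) / ((x : ℝ) * x) + (∑ z ∈ W ×ˢ W, D z.1 z.2) / ((y : ℝ) * y)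
       - 2 * ((∑ z ∈ U ×ˢ W, D z.1 z.2) / ((x : ℝ) * y)) := by
    have gen : ∀ (P Q : Finset H) (p q : ℝ), ∑ h, ∑ k, D h k * (if h ∈ P then p else 0) *
        (if k ∈ Q then q else 0) = (∑ z ∈ P ×ˢ Q, D z.1 z.2) * (p * q) := by
      intro P Q p q
      rw [Finset.sum_product, Finset.sum_mul]
      simp only [mul_ite, ite_mul, mul_zero, zero_mul]
      rw [← Finset.sum_subset (Finset.subset_univ P)]
      · apply Finset.sum_congr rfl
        intro h hh
        rw [← Finset.sum_filter, Finset.filter_univ_mem, Finset.sum_mul]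
        apply Finset.sum_congr rfl
        intro k _
        rw [if_pos hh]; ring
      · intro h _ hh
        simp [hh]
    have hWU : ∑ z ∈ W ×ˢ U, D z.1 z.2 = ∑ z ∈ U ×ˢ W, D z.1 z.2 := by
      rw [Finset.sum_product, Finset.sum_product_right]
      apply Finset.sum_congr rfl; intro h _
      apply Finset.sum_congr rfl; intro k _
      exact hsym _ _
    have g1 := gen U U (1 / x) (1 / x)
    have g2 := gen U W (1 / x) (1 / y)
    have g3 := gen W U (1 / y) (1 / x)
    have g4 := gen W W (1 / y) (1 / y)
    rw [hWU] at g3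
    simp only [mul_sub, sub_mul, Finset.sum_sub_distrib]
    rw [g1, g2, g3, g4]
    field_simp
    ring
  rw [hexp] at hc
  push_cast
  linarith

theorem MM_lipX (hd : Disjoint X Y) (hu : X ∪ Y = univ) {φ : Finset (Sym2 H) → ℝ} {κ : ℝ}
    (hφ : ∀ m, ∃ D, Incr φ κ m D) (a b c : ℕ) (ha : 2 * (a + 1) + c ≤ X.card)
    (hb : 2 * b + c ≤ Y.card) : |avg (MM X Y (a + 1) b c) φ - avg (MM X Y a b c) φ| ≤ κ := by
  have hne := MM_nonempty hd hu a b c (by omega) hb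
  obtain ⟨x, hx⟩ : ∃ x, x + 2 * a + c = X.card := ⟨X.card - 2 * a - c, by omega⟩
  rw [(MM_transferX hd hu hx (by omega) hne).2 φ]
  apply avg_abs hne
  intro m hm
  obtain ⟨D, hD⟩ := hφ m
  apply addable_abs hD
  · rw [addable_self, Finset.offDiag_card, MM_cardX hd hu hx m hm]
  · have : x * 2 ≤ x * x := Nat.mul_le_mul_left x (by omega)
    omega

theorem MM_lipY (hd : Disjoint X Y) (hu : X ∪ Y = univ) {φ : Finset (Sym2 H) → ℝ} {κ : ℝ}
    (hφ : ∀ m, ∃ D, Incr φ κ m D) (a b c : ℕ) (ha : 2 * a + c ≤ X.card)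
    (hb : 2 * (b + 1) + c ≤ Y.card) :
    |avg (MM X Y a (b + 1) c) φ - avg (MM X Y a b c) φ| ≤ κ := by
  have hne := MM_nonempty hd hu a b c ha (by omega)
  obtain ⟨x, hx⟩ : ∃ x, x + 2 * b + c = Y.card := ⟨Y.card - 2 * b - c, by omega⟩
  rw [(MM_transferY hd hu hx (by omega) hne).2 φ]
  apply avg_abs hne
  intro m hm
  obtain ⟨D, hD⟩ := hφ m
  apply addable_abs hD
  · rw [addable_self, Finset.offDiag_card, MM_cardY hd hu hx m hm]
  · have : x * 2 ≤ x * x := Nat.mul_le_mul_left x (by omega)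
    omega

theorem MM_lipC (hd : Disjoint X Y) (hu : X ∪ Y = univ) {φ : Finset (Sym2 H) → ℝ} {κ : ℝ}
    (hφ : ∀ m, ∃ D, Incr φ κ m D) (a b c : ℕ) (ha : 2 * a + (c + 1) ≤ X.card)
    (hb : 2 * b + (c + 1) ≤ Y.card) :
    |avg (MM X Y a b (c + 1)) φ - avg (MM X Y a b c) φ| ≤ κ := by
  have hne := MM_nonempty hd hu a b c (by omega) (by omega)
  obtain ⟨x, hx⟩ : ∃ x, x + 2 * a + c = X.card := ⟨X.card - 2 * a - c, by omega⟩
  obtain ⟨y, hy⟩ : ∃ x, x + 2 * b + c = Y.card := ⟨Y.card - 2 * b - c, by omega⟩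
  rw [(MM_transferC hd hu hx hy (by omega) (by omega) hne).2 φ]
  apply avg_abs hne
  intro m hm
  obtain ⟨D, hD⟩ := hφ m
  apply addable_abs hD
  · rw [addable_cross hd, Finset.card_product, MM_cardX hd hu hx m hm, MM_cardY hd hu hy m hm]
  · exact Nat.mul_pos (by omega) (by omega)

theorem MM_concave (hd : Disjoint X Y) (hu : X ∪ Y = univ) {φ : Finset (Sym2 H) → ℝ} {κ : ℝ}
    (hφ : ∀ m, ∃ D, Incr φ κ m D) (a b c x y : ℕ) (hx : x + 2 * a + c = X.card)
    (hy : y + 2 * b + c = Y.card) (hx2 : 2 ≤ x) (hy2 : 2 ≤ y) :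
    avg (MM X Y (a + 1) b c) φ + avg (MM X Y a (b + 1) c) φ ≤
      2 * avg (MM X Y a b (c + 1)) φ + 2 * κ / x + 2 * κ / y := by
  have hne := MM_nonempty hd hu a b c (by omega) (by omega)
  rw [(MM_transferC hd hu hx hy (by omega) (by omega) hne).2 φ,
    (MM_transferX hd hu hx hx2 hne).2 φ, (MM_transferY hd hu hy hy2 hne).2 φ, two_mul,
    ← avg_add, ← avg_add, add_assoc, ← avg_add_const hne]
  apply avg_le_avg
  intro m hm
  obtain ⟨D, hD⟩ := hφ m
  have cX := MM_cardX hd hu hx m hm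
  have cY := MM_cardY hd hu hy m hm
  have px : 0 < x * x - x := by
    have : x * 2 ≤ x * x := Nat.mul_le_mul_left x (by omega)
    omega
  have py : 0 < y * y - y := by
    have : y * 2 ≤ y * y := Nat.mul_le_mul_left y (by omega)
    omega
  have pc : 0 < x * y := Nat.mul_pos (by omega) (by omega)
  rw [addable_sum hD X X (by rw [addable_self, Finset.offDiag_card, cX]) px,
    addable_sum hD Y Y (by rw [addable_self, Finset.offDiag_card, cY]) py,
    addable_sum hD X Y (by rw [addable_cross hd, Finset.card_product, cX, cY]) pc,
    addable_self, addable_self, addable_cross hd]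
  have := concave_local hD.1 hD.2.1 hD.2.2.2 (frees X m) (frees Y m) cX cY hx2 hy2
  linarith

end comb

theorem pcnt_self_eq {H : Type} [Fintype H] [DecidableEq H] {m : Finset (Sym2 H)}
    (hm : IsPairMatching m) (P : Finset H) :
    pcnt P P m = 2 * (m.filter fun p => ∀ h ∈ p, h ∈ P).card := by
  unfold pcnt
  rw [Finset.card_eq_sum_card_fiberwise (f := fun x : H × H => s(x.1, x.2))
    (t := m.filter fun p => ∀ h ∈ p, h ∈ P)]
  · rw [mul_comm, ← smul_eq_mul, ← Finset.sum_const]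
    apply Finset.sum_congr rfl
    intro p hp
    induction p using Sym2.ind with
    | _ x y =>
    simp only [mem_filter, Sym2.mem_iff, forall_eq_or_imp, forall_eq] at hp
    have hne : x ≠ y := by simpa using hm.1 _ hp.1
    rw [← Finset.card_pair (a := (x, y)) (b := (y, x)) (by simp [hne])]
    congr 1
    ext ⟨u, v⟩
    simp only [mem_filter, mem_product, mem_insert, mem_singleton, Prod.mk.injEq, Sym2.eq_iff]
    constructor
    · rintro ⟨_, h⟩; exact h
    · rintro (⟨rfl, rfl⟩ | ⟨rfl, rfl⟩)
      · exact ⟨⟨hp.2, hp.1⟩, by simp⟩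
      · exact ⟨⟨⟨hp.2.2, hp.2.1⟩, by rw [Sym2.eq_swap]; exact hp.1⟩, by simp⟩
  · rintro ⟨x, y⟩ h
    simp only [coe_filter, mem_product, Set.mem_ofPred_eq, Sym2.mem_iff, forall_eq_or_imp,
      forall_eq] at h ⊢
    exact ⟨h.2, h.1⟩

theorem pcnt_cross_eq {H : Type} [Fintype H] [DecidableEq H] {m : Finset (Sym2 H)}
    {P Q : Finset H} (hd : Disjoint P Q) :
    pcnt P Q m = (m.filter fun p => (∃ h ∈ p, h ∈ P) ∧ ∃ h ∈ p, h ∈ Q).card := by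
  unfold pcnt
  have hd' := Finset.disjoint_left.1 hd
  apply Finset.card_bij (fun x _ => s(x.1, x.2))
  · rintro ⟨x, y⟩ h
    simp only [mem_filter, mem_product] at h ⊢
    exact ⟨h.2, ⟨x, by simp, h.1.1⟩, ⟨y, by simp, h.1.2⟩⟩
  · rintro ⟨x, y⟩ h ⟨x', y'⟩ h' he
    simp only [mem_filter, mem_product, Sym2.eq_iff] at h h' he
    rcases he with ⟨rfl, rfl⟩ | ⟨rfl, rfl⟩
    · rfl
    · exact absurd h'.1.2 (hd' h.1.1)
  · intro p hp
    simp only [mem_filter] at hp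
    obtain ⟨hp, ⟨x, hx, hxP⟩, ⟨y, hy, hyQ⟩⟩ := hp
    have hne : x ≠ y := by rintro rfl; exact hd' hxP hyQ
    have he : p = s(x, y) := (Sym2.mem_and_mem_iff hne).1 ⟨hx, hy⟩
    subst he
    exact ⟨(x, y), by simp [hxP, hyQ, hp], rfl⟩

theorem Fav_eq_avg (f : Multigraph → ℝ) (V : Type) [Fintype V] [DecidableEq V] (A B : Finset V)
    (hAB : Disjoint A B) (d : V → ℕ) (a b c : ℕ) :
    Fav V d A B f a b c = avg (MM (univ.filter fun h : HalfEdge V d => h.1 ∈ A)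
      (univ.filter fun h : HalfEdge V d => h.1 ∈ B) a b c) (fun m => f (matchingGraph V d m)) := by
  have hd : Disjoint (univ.filter fun h : HalfEdge V d => h.1 ∈ A)
      (univ.filter fun h : HalfEdge V d => h.1 ∈ B) := by
    rw [Finset.disjoint_left]
    intro h h1 h2
    simp only [mem_filter, mem_univ, true_and] at h1 h2
    exact Finset.disjoint_left.1 hAB h1 h2
  have hM : Mset V d A B a b c = MM (univ.filter fun h : HalfEdge V d => h.1 ∈ A)
      (univ.filter fun h : HalfEdge V d => h.1 ∈ B) a b c := by
    ext m
    simp only [Mset, MM, mem_filter, mem_univ, true_and]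
    apply and_congr_right
    intro hm
    rw [pcnt_self_eq hm, pcnt_self_eq hm, pcnt_cross_eq hd]
    simp only [mem_filter, mem_univ, true_and]
    have e1 : ∀ A : Finset V, (m.filter fun p => bothEnds A p) =
      (m.filter fun p => ∀ h ∈ p, h.1 ∈ A) := by
      intro A; ext p; rw [mem_filter, mem_filter]; rfl
    have e2 : (m.filter fun p => crossEnds A B p) =
      (m.filter fun p => (∃ h ∈ p, h.1 ∈ A) ∧ ∃ h ∈ p, h.1 ∈ B) := by
      ext p; rw [mem_filter, mem_filter]; rfl
    rw [e1, e1, e2]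
    refine and_congr ?_ (and_congr ?_ Iff.rfl)
    · omega
    · omega
  unfold Fav avg
  rw [hM]

theorem addEdge_comm (G : Multigraph) (i j : G.V) : G.addEdge i j = G.addEdge j i := by
  unfold Multigraph.addEdge
  rw [Sym2.eq_swap]

theorem graph_incr (f : Multigraph → ℝ) (κ : ℝ)
    (hlip : GraphParam.Lipschitz f κ) (hconc : GraphParam.Concave f)
    (V : Type) [Fintype V] [DecidableEq V] (d : V → ℕ) (m : Finset (Sym2 (HalfEdge V d))) :
    ∃ D, Incr (fun m => f (matchingGraph V d m)) κ m D := by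
  refine ⟨fun h k => f ((matchingGraph V d m).addEdge h.1 k.1) - f (matchingGraph V d m),
    ?_, ?_, ?_, ?_⟩
  · intro h k
    have : (matchingGraph V d m).addEdge h.1 k.1 = (matchingGraph V d m).addEdge k.1 h.1 :=
      addEdge_comm _ _ _
    simp only [this]
  · intro h k
    exact hlip _ _ _
  · intro h k hn
    have : matchingGraph V d (insert s(h, k) m) = (matchingGraph V d m).addEdge h.1 k.1 := by
      unfold matchingGraph Multigraph.addEdge
      simp only [Finset.insert_val_of_notMem hn, Multiset.map_cons, Sym2.map_mk]
    simp only [this]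
    ring
  · intro y hy
    have hc := hconc (matchingGraph V d m) (fun i : V => ∑ s : Fin (d i), y ⟨i, s⟩) (by
      rw [← hy, Fintype.sum_sigma]
      rfl)
    refine le_trans (le_of_eq ?_) hc
    rw [Fintype.sum_sigma]
    apply Finset.sum_congr rfl
    intro i _
    simp only [Fintype.sum_sigma]
    rw [Finset.sum_comm]
    apply Finset.sum_congr rfl
    intro j _
    simp only [Finset.mul_sum, Finset.sum_mul]
    rw [Finset.sum_comm]

theorem card_half (V : Type) [Fintype V] [DecidableEq V] (d : V → ℕ) (A : Finset V) :
    (univ.filter fun h : HalfEdge V d => h.1 ∈ A).card = ∑ i ∈ A, d i := by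
  have : (univ.filter fun h : HalfEdge V d => h.1 ∈ A) =
      A.sigma fun i => (univ : Finset (Fin (d i))) := by
    ext ⟨i, s⟩; simp
  rw [this, Finset.card_sigma]
  simp

theorem statement5 (f : Multigraph → ℝ) (κ : ℝ)
    (hinv : GraphParam.Invariant f) (hadd : GraphParam.Additive f)
    (hlip : GraphParam.Lipschitz f κ) (hconc : GraphParam.Concave f)
    (V : Type) [Fintype V] [DecidableEq V] (A B : Finset V)
    (hAB : Disjoint A B) (hUnion : A ∪ B = Finset.univ) (d : V → ℕ)
    (γ : ℕ) (hγ : γ ≤ min (∑ i ∈ A, d i) (∑ i ∈ B, d i)) :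
    Fav V d A B f ((∑ i ∈ A, d i) / 2) ((∑ i ∈ B, d i) / 2) 0 ≤
      Fav V d A B f (((∑ i ∈ A, d i) - γ) / 2) (((∑ i ∈ B, d i) - γ) / 2) γ +
        7 * κ * Real.sqrt ((γ : ℝ) * Real.log (1 + (γ : ℝ))) := by
  have hκ : 0 ≤ κ := le_trans (abs_nonneg _)
    (hlip { V := Unit, edges := 0 } () ())
  have hd : Disjoint (univ.filter fun h : HalfEdge V d => h.1 ∈ A)
      (univ.filter fun h : HalfEdge V d => h.1 ∈ B) := by
    rw [Finset.disjoint_left]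
    intro h h1 h2
    simp only [mem_filter, mem_univ, true_and] at h1 h2
    exact Finset.disjoint_left.1 hAB h1 h2
  have hu : (univ.filter fun h : HalfEdge V d => h.1 ∈ A) ∪
      (univ.filter fun h : HalfEdge V d => h.1 ∈ B) = univ := by
    ext h
    have : h.1 ∈ A ∪ B := by rw [hUnion]; exact mem_univ _
    simpa using this
  have hφ := graph_incr f κ hlip hconc V d
  simp only [Fav_eq_avg f V A B hAB d]
  rw [← card_half V d A, ← card_half V d B] at hγ ⊢
  exact arith_main (fun a b c => avg (MM (univ.filter fun h : HalfEdge V d => h.1 ∈ A)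
      (univ.filter fun h : HalfEdge V d => h.1 ∈ B) a b c) (fun m => f (matchingGraph V d m)))
    _ _ κ hκ (MM_lipX hd hu hφ) (MM_lipY hd hu hφ) (MM_lipC hd hu hφ) (MM_concave hd hu hφ) γ
    (le_trans hγ (min_le_left _ _)) (le_trans hγ (min_le_right _ _))
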